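/- arXiv:1703.09326 — 3 statements merged into one kernel-verified Lean document; each statement's English description precedes it below -/
import Mathlib

section
/- (Abstract form of Theorem 3 / preservation of stabilization under the transformation.) Let (σ, R) and (σ', R') be transition systems and h : σ → σ' a map. Suppose: (i) (σ, R) is stabilizing to S ⊆ σ; (ii) for every s ∈ S and every computation c' of (σ', R') with c' 0 = h s, there exists a computation c of (σ, R) with c 0 = s and c' n = h (c n) for all n; and (iii) every computation c' of (σ', R') has a suffix which is the h-image of some computation of (σ, R), i.e., there exist N and a computation c of (σ, R) with c' (N + n) = h (c n) for all n. Then (σ', R') is stabilizing to the image h '' S. -/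
/-- A computation of a transition system `(σ, R)` is an infinite sequence of
states each related to the next by `R`. -/
def IsComputation {σ : Type*} (R : σ → σ → Prop) (c : ℕ → σ) : Prop :=
  ∀ n, R (c n) (c (n + 1))

/-- A transition system `(σ, R)` is stabilizing to `S` iff every computation
reaches `S` (convergence) and every computation starting in `S` stays in `S`
(closure). -/
def Stabilizing {σ : Type*} (R : σ → σ → Prop) (S : Set σ) : Prop :=
  (∀ c : ℕ → σ, IsComputation R c → ∃ n, c n ∈ S) ∧
  (∀ c : ℕ → σ, IsComputation R c → c 0 ∈ S → ∀ n, c n ∈ S)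

/-- Abstract preservation of stabilization under the transformation: if
`(σ, R)` is stabilizing to `S`, computations of `(σ', R')` starting at images
of states in `S` lift to computations of `(σ, R)`, and every computation of
`(σ', R')` has a suffix that is the `h`-image of some computation of `(σ, R)`,
then `(σ', R')` is stabilizing to `h '' S`. -/
theorem stabilizing_image_of_transform
    {σ σ' : Type*} (R : σ → σ → Prop) (R' : σ' → σ' → Prop) (h : σ → σ')
    (S : Set σ)
    (hstab : Stabilizing R S)
    (hlift : ∀ s ∈ S, ∀ c' : ℕ → σ', IsComputation R' c' → c' 0 = h s →
      ∃ c : ℕ → σ, IsComputation R c ∧ c 0 = s ∧ ∀ n, c' n = h (c n))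
    (hsuffix : ∀ c' : ℕ → σ', IsComputation R' c' →
      ∃ (N : ℕ) (c : ℕ → σ), IsComputation R c ∧ ∀ n, c' (N + n) = h (c n)) :
    Stabilizing R' (h '' S) := by
  constructor
  · intro c' hc'
    obtain ⟨N, c, hc, hcc'⟩ := hsuffix c' hc'
    obtain ⟨n, hn⟩ := hstab.1 c hc
    exact ⟨N + n, c n, hn, (hcc' n).symm⟩
  · rintro c' hc' ⟨s, hs, hs'⟩ n
    obtain ⟨c, hc, hc0, hcc'⟩ := hlift s hs c' hc' hs'.symm
    exact ⟨c n, hstab.2 c hc (hc0 ▸ hs) n, (hcc' n).symm⟩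
end

section
/- (Region agreement.) Let n ≥ 1 and let f : Fin n → ℕ → ℤ assign to each process i its region f i t at each discrete time t. Assume: (monotonicity) f i t ≤ f i (t+1) for all i, t; (unit steps) f i (t+1) ≤ f i t + 1 for all i, t; (interleaving) at each time t there is at most one i with f i (t+1) ≠ f i t; and (bounded drift) |f i t − f j t| ≤ 1 for all i, j, t. Let r : ℤ and suppose f i 0 ≤ r for every i, and that there exist some process i₀ and time T with f i₀ T ≥ r + 1. Then there exists a time t at which all processes are in region r simultaneously: f i t = r for every i. (This is the claim that just before the first process moves to region r+1, all processes must be in the same region r.) -/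
/-- Region agreement: if process regions never decrease, increase by at most 1
per step, at most one process changes its region per step, regions of any two
processes differ by at most 1 at all times, all processes start in region at
most `r`, and some process eventually reaches region at least `r + 1`, then
there is a time at which all processes are simultaneously in region `r`. -/
theorem region_agreement
    (n : ℕ) (hn : 1 ≤ n) (f : Fin n → ℕ → ℤ)
    (hmono : ∀ (i : Fin n) (t : ℕ), f i t ≤ f i (t + 1))
    (hunit : ∀ (i : Fin n) (t : ℕ), f i (t + 1) ≤ f i t + 1)
    (hinter : ∀ (t : ℕ) (i j : Fin n),
      f i (t + 1) ≠ f i t → f j (t + 1) ≠ f j t → i = j)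
    (hdrift : ∀ (i j : Fin n) (t : ℕ), |f i t - f j t| ≤ 1)
    (r : ℤ) (h0 : ∀ i : Fin n, f i 0 ≤ r)
    (i₀ : Fin n) (T : ℕ) (hT : r + 1 ≤ f i₀ T) :
    ∃ t : ℕ, ∀ i : Fin n, f i t = r := by
  induction T generalizing i₀ with
  | zero => linarith [h0 i₀]
  | succ s ih =>
    by_cases hs : ∃ i, r + 1 ≤ f i s
    · obtain ⟨i, hi⟩ := hs
      exact ih i hi
    · push Not at hs
      have hi₀ := hs i₀
      refine ⟨s, fun j => ?_⟩
      have hj := hs j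
      have hu := hunit i₀ s
      by_cases hji : j = i₀
      · subst hji
        omega
      · have hstay : f j (s + 1) = f j s := by
          by_contra hne
          exact hji (hinter s j i₀ hne (by omega))
        have hd := (abs_le.mp (hdrift i₀ j (s + 1))).2
        omega
end

section
/- (Well-definedness of convertdc and the range-size identity.) Let max_inc ≥ 1 and max_r ≥ 0 be natural numbers, let r ≥ max_r + 2, and set MAXBOUND = 3 · max_inc · (11 + 3 · max_r), mindep = 3 · (r − 2 − max_r) · max_inc, and maxdep = 3 · (r + 1) · max_inc + 2 · max_inc − 1. Then: (a) the size of the dependent-counter range satisfies maxdep − mindep + 1 = max_inc · (11 + 3 · max_r), which equals MAXBOUND / 3; and (b) for every natural number x there is at most one natural number y with mindep ≤ y ≤ maxdep and y % MAXBOUND = x % MAXBOUND. (Hence the value of a dependent counter of a process in region r, which in legitimate states lies in [mindep .. maxdep], is uniquely recoverable from its value modulo MAXBOUND.) -/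
/-- Two natural numbers in a window of length at most `m` with equal residues modulo `m` agree. -/
theorem Nat.eq_of_mod_eq_of_lt_add {a m y₁ y₂ : ℕ} (ha₁ : a ≤ y₁) (hb₁ : y₁ < a + m)
    (ha₂ : a ≤ y₂) (hb₂ : y₂ < a + m) (h : y₁ % m = y₂ % m) : y₁ = y₂ := by
  have h' : y₁ ≡ y₂ [MOD m] := h
  exact h'.eq_of_abs_lt (by rw [abs_lt]; constructor <;> omega)

/-- Well-definedness of `convertdc` and the range-size identity: for
`MAXBOUND = 3·max_inc·(11 + 3·max_r)`, `mindep = 3·(r - 2 - max_r)·max_inc`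
and `maxdep = 3·(r+1)·max_inc + 2·max_inc - 1` (with `r ≥ max_r + 2`):
(a) `maxdep - mindep + 1 = max_inc·(11 + 3·max_r) = MAXBOUND / 3`, and
(b) any value in the legitimate dependent-counter range `[mindep .. maxdep]`
is uniquely determined by its residue modulo `MAXBOUND`. -/
theorem convertdc_well_defined
    (max_inc max_r r : ℕ) (h1 : 1 ≤ max_inc) (hr : max_r + 2 ≤ r)
    (MAXBOUND mindep maxdep : ℕ)
    (hMB : MAXBOUND = 3 * max_inc * (11 + 3 * max_r))
    (hmin : mindep = 3 * (r - 2 - max_r) * max_inc)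
    (hmax : maxdep = 3 * (r + 1) * max_inc + 2 * max_inc - 1) :
    (maxdep - mindep + 1 = max_inc * (11 + 3 * max_r) ∧
      maxdep - mindep + 1 = MAXBOUND / 3) ∧
    (∀ x y₁ y₂ : ℕ,
      (mindep ≤ y₁ ∧ y₁ ≤ maxdep ∧ y₁ % MAXBOUND = x % MAXBOUND) →
      (mindep ≤ y₂ ∧ y₂ ≤ maxdep ∧ y₂ % MAXBOUND = x % MAXBOUND) →
      y₁ = y₂) := by
  obtain ⟨k, rfl⟩ := Nat.exists_eq_add_of_le hr
  have hk : max_r + 2 + k - 2 - max_r = k := by omega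
  rw [hk] at hmin
  have hsize : 3 * (max_r + 2 + k + 1) * max_inc + 2 * max_inc
      = mindep + max_inc * (11 + 3 * max_r) := by
    rw [hmin]; ring
  have hpos : 0 < max_inc * (11 + 3 * max_r) := by positivity
  have hMB' : MAXBOUND = 3 * (max_inc * (11 + 3 * max_r)) := by rw [hMB, mul_assoc]
  refine ⟨by omega, ?_⟩
  rintro x y₁ y₂ ⟨ha₁, hb₁, h₁⟩ ⟨ha₂, hb₂, h₂⟩
  exact Nat.eq_of_mod_eq_of_lt_add (m := MAXBOUND) ha₁ (by omega) ha₂ (by omega)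
    (h₁.trans h₂.symm)
end
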